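/- Let m ≥ 2, z_1 ∈ {0, 1/m, …, (m−2)/m}, z_2 ∈ {0, 1/m, …, (m−1)/m}, and let Ω and Ω̃ be as follows: Ω is the jittered partition of [0,1]² into m² axis-aligned squares of side 1/m, and Ω̃ is obtained from Ω by replacing the two squares whose union is I = [1−z_1−2/m, 1−z_1] × [1−z_2−1/m, 1−z_2] by the triangles conv{(1−z_1−2/m, 1−z_2−1/m), (1−z_1, 1−z_2−1/m), (1−z_1−2/m, 1−z_2)} and its complementary triangle in I. Then E L2²(P_Ω̃) < E L2²(P_Ω) if and only if z_2 < 2/(9m) + z_1/3. -/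

import Mathlib

open MeasureTheory ProbabilityTheory

noncomputable section

namespace StratifiedSampling

variable {d : ℕ} {ι : Type} [Fintype ι]

/-- Lebesgue volume of a subset of `ℝ^d` as a real number. -/
def vol (s : Set (Fin d → ℝ)) : ℝ := (volume s).toReal

/-- Number of points of the configuration `p` that lie in the lower box `(-∞, x]`. -/
def countIn (p : ι → (Fin d → ℝ)) (x : Fin d → ℝ) : ℝ :=
  ∑ i, Set.indicator (Set.Iic x) (fun _ => (1 : ℝ)) (p i)

/-- Discrepancy function of the point configuration `p` in the set `K`:
`d_P(x) = #(P ∩ (-∞,x])/N − |K ∩ (-∞,x]|/|K|`. -/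
def discrep (K : Set (Fin d → ℝ)) (p : ι → (Fin d → ℝ)) (x : Fin d → ℝ) : ℝ :=
  countIn p x / (Fintype.card ι : ℝ) - vol (K ∩ Set.Iic x) / vol K

/-- Joint distribution of the stratified sample associated with the family `Ω`:
the points are independent and the `i`-th point is uniformly distributed on `Ω i`. -/
def stratDist (Ω : ι → Set (Fin d → ℝ)) : Measure (ι → (Fin d → ℝ)) :=
  Measure.pi fun i => ProbabilityTheory.cond volume (Ω i)

/-- Mean squared `L2`-discrepancy of the stratified sample from the family `Ω` in `K`:
`E L2²(P_Ω) = E[(1/|K|) ∫_K d_{P_Ω}(x)² dx]`. -/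
def meanL2sq (K : Set (Fin d → ℝ)) (Ω : ι → Set (Fin d → ℝ)) : ℝ :=
  ∫ p, ((1 / vol K) * ∫ x in K, (discrep K p x) ^ 2) ∂(stratDist Ω)

/-- `Ω` is a partition of `K`: measurable sets of positive volume whose union
is `K` and whose distinct members have disjoint interiors. -/
structure IsPartition (K : Set (Fin d → ℝ)) (Ω : ι → Set (Fin d → ℝ)) : Prop where
  measurableSet : ∀ i, MeasurableSet (Ω i)
  vol_pos : ∀ i, 0 < volume (Ω i)
  iUnion_eq : (⋃ i, Ω i) = K
  disjoint_interiors : ∀ i j, i ≠ j → interior (Ω i) ∩ interior (Ω j) = ∅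

/-- All members of `Ω` have the same volume. -/
def IsEquivolume (Ω : ι → Set (Fin d → ℝ)) : Prop :=
  ∀ i j, volume (Ω i) = volume (Ω j)

/-- `q_i(x) = |Ω_i ∩ (-∞,x]| / |Ω_i|`. -/
def qfun (Ω : ι → Set (Fin d → ℝ)) (i : ι) (x : Fin d → ℝ) : ℝ :=
  vol (Ω i ∩ Set.Iic x) / vol (Ω i)

end StratifiedSampling

namespace StratifiedSampling

/-- The jittered square with multi-index `i`: `∏_k [i_k/m, (i_k+1)/m]`. -/
def jitteredCube {d : ℕ} (m : ℕ) (j : Fin d → Fin m) : Set (Fin d → ℝ) :=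
  Set.Icc (fun k => (j k : ℝ) / m) (fun k => ((j k : ℝ) + 1) / m)

/-- The rectangle `I = [1−z₁−2/m, 1−z₁] × [1−z₂−1/m, 1−z₂]`, where `z₁ = j/m`,
`z₂ = k/m`. -/
def rectI (m j k : ℕ) : Set (Fin 2 → ℝ) :=
  Set.Icc ![1 - (j : ℝ) / m - 2 / m, 1 - (k : ℝ) / m - 1 / m]
    ![1 - (j : ℝ) / m, 1 - (k : ℝ) / m]

/-- The triangle `conv{(1−z₁−2/m, 1−z₂−1/m), (1−z₁, 1−z₂−1/m), (1−z₁−2/m, 1−z₂)}`. -/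
def tri₁ (m j k : ℕ) : Set (Fin 2 → ℝ) :=
  convexHull ℝ {![1 - (j : ℝ) / m - 2 / m, 1 - (k : ℝ) / m - 1 / m],
    ![1 - (j : ℝ) / m, 1 - (k : ℝ) / m - 1 / m],
    ![1 - (j : ℝ) / m - 2 / m, 1 - (k : ℝ) / m]}

/-- The complementary triangle `I ∖ int(tri₁)`. -/
def tri₂ (m j k : ℕ) : Set (Fin 2 → ℝ) := rectI m j k \ interior (tri₁ m j k)

/-- Multi-index of the left of the two replaced jittered squares. -/
def idxL (m j k : ℕ) (hm : 2 ≤ m) (hj : j ≤ m - 2) (hk : k ≤ m - 1) : Fin 2 → Fin m :=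
  fun i => if (i : ℕ) = 0 then ⟨m - 2 - j, by omega⟩ else ⟨m - 1 - k, by omega⟩

/-- Multi-index of the right of the two replaced jittered squares. -/
def idxR (m j k : ℕ) (hm : 2 ≤ m) (hj : j ≤ m - 2) (hk : k ≤ m - 1) : Fin 2 → Fin m :=
  fun i => if (i : ℕ) = 0 then ⟨m - 1 - j, by omega⟩ else ⟨m - 1 - k, by omega⟩

section MeanSquaredDiscrepancy

variable {d : ℕ} {ι : Type}

lemma isProbabilityMeasure_cond_volume (Ω : ι → Set (Fin d → ℝ)) (hpos : ∀ i, volume (Ω i) ≠ 0)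
    (hfin : ∀ i, volume (Ω i) ≠ ⊤) (i : ι) :
    IsProbabilityMeasure (ProbabilityTheory.cond volume (Ω i)) :=
  ProbabilityTheory.cond_isProbabilityMeasure_of_finite (hpos i) (hfin i)

lemma cond_real_Iic (Ω : ι → Set (Fin d → ℝ)) (hmeas : ∀ i, MeasurableSet (Ω i)) (i : ι)
    (x : Fin d → ℝ) :
    (ProbabilityTheory.cond volume (Ω i)).real (Set.Iic x) = qfun Ω i x := by
  rw [Measure.real, cond_apply (hmeas i), ENNReal.toReal_mul, ENNReal.toReal_inv, qfun, vol, vol]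
  ring

lemma measurable_vol_inter_Iic {K : Set (Fin d → ℝ)} (hK : MeasurableSet K) :
    Measurable fun x => vol (K ∩ Set.Iic x) := by
  have hle : MeasurableSet {p : (Fin d → ℝ) × (Fin d → ℝ) | p.2 ≤ p.1} :=
    (isClosed_le continuous_snd continuous_fst).measurableSet
  exact (measurable_measure_prodMk_left (ν := volume)
    ((measurable_snd hK).inter hle)).ennreal_toReal

variable [Fintype ι]

lemma measurable_discrep {K : Set (Fin d → ℝ)} (hK : MeasurableSet K) :
    Measurable fun z : (ι → (Fin d → ℝ)) × (Fin d → ℝ) => discrep K z.1 z.2 := by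
  unfold discrep countIn
  refine Measurable.sub (Measurable.div_const (Finset.measurable_sum _ fun i _ => ?_) _)
    (((measurable_vol_inter_Iic hK).comp measurable_snd).div_const _)
  have hle : MeasurableSet {z : (ι → (Fin d → ℝ)) × (Fin d → ℝ) | z.1 i ≤ z.2} :=
    (isClosed_le ((continuous_apply i).comp continuous_fst) continuous_snd).measurableSet
  exact (measurable_const (a := (1 : ℝ))).indicator hle

lemma discrep_sq_le_one {K : Set (Fin d → ℝ)} (hK : volume K ≠ ⊤) (p : ι → (Fin d → ℝ))
    (x : Fin d → ℝ) : (discrep K p x) ^ 2 ≤ 1 := by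
  have h1 : 0 ≤ countIn p x :=
    Finset.sum_nonneg fun i _ => Set.indicator_nonneg (fun _ _ => zero_le_one) _
  have h2 : countIn p x ≤ Fintype.card ι := by
    refine (Finset.sum_le_sum fun i _ => Set.indicator_le_self' (f := fun _ => (1 : ℝ))
      (fun _ _ => zero_le_one) (p i)).trans ?_
    simp
  have h3 : vol (K ∩ Set.Iic x) ≤ vol K :=
    ENNReal.toReal_mono hK (measure_mono Set.inter_subset_left)
  have h4 : 0 ≤ vol (K ∩ Set.Iic x) := ENNReal.toReal_nonneg
  have h5 := div_le_one_of_le₀ h2 (Nat.cast_nonneg _)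
  have h6 := div_le_one_of_le₀ h3 ENNReal.toReal_nonneg
  have h7 : 0 ≤ countIn p x / Fintype.card ι := by positivity
  have h8 : 0 ≤ vol (K ∩ Set.Iic x) / vol K := div_nonneg h4 ENNReal.toReal_nonneg
  rw [sq_le_one_iff_abs_le_one, abs_le, discrep]
  constructor <;> linarith

/-- Bias-variance decomposition of the squared discrepancy of a stratified sample. -/
lemma integral_discrep_sq (K : Set (Fin d → ℝ)) (Ω : ι → Set (Fin d → ℝ))
    (hmeas : ∀ i, MeasurableSet (Ω i)) (hpos : ∀ i, volume (Ω i) ≠ 0)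
    (hfin : ∀ i, volume (Ω i) ≠ ⊤) (x : Fin d → ℝ) :
    ∫ p, (discrep K p x) ^ 2 ∂(stratDist Ω) =
      (∑ i, (qfun Ω i x - qfun Ω i x ^ 2)) / (Fintype.card ι : ℝ) ^ 2 +
        ((∑ i, qfun Ω i x) / (Fintype.card ι : ℝ) - vol (K ∩ Set.Iic x) / vol K) ^ 2 := by
  have := isProbabilityMeasure_cond_volume Ω hpos hfin
  unfold stratDist
  set μ := Measure.pi fun i => ProbabilityTheory.cond volume (Ω i) with hμ
  set f : (Fin d → ℝ) → ℝ := Set.indicator (Set.Iic x) (fun _ => (1 : ℝ)) with hf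
  have hfm : Measurable f := measurable_const.indicator measurableSet_Iic
  have hfb : ∀ y, ‖f y‖ ≤ 1 := fun y => by
    simp only [hf, Set.indicator]; split_ifs <;> simp
  set Y : ι → (ι → (Fin d → ℝ)) → ℝ := fun i p => f (p i) with hY
  have hYm : ∀ i, Measurable (Y i) := fun i => hfm.comp (measurable_pi_apply i)
  have hYL : ∀ i, MemLp (Y i) 2 μ := fun i =>
    MemLp.of_bound (hYm i).aestronglyMeasurable 1 (Filter.Eventually.of_forall fun p => hfb _)
  have hEf : ∀ i, ∫ p, Y i p ∂μ = qfun Ω i x := fun i => by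
    rw [← cond_real_Iic Ω hmeas, ← integral_indicator_one measurableSet_Iic]
    have h := measurePreserving_eval (fun i => ProbabilityTheory.cond volume (Ω i)) i
    rw [← h.map_eq, integral_map h.measurable.aemeasurable
      (measurable_one.indicator measurableSet_Iic).aestronglyMeasurable]
    rfl
  have hsq : ∀ i, Y i ^ 2 = Y i := fun i => by
    funext p
    simp only [hY, hf, Pi.pow_apply, Set.indicator]; split_ifs <;> simp
  have hvar : ∀ i, variance (Y i) μ = qfun Ω i x - qfun Ω i x ^ 2 := fun i => by
    rw [variance_eq_sub (hYL i), hsq, hEf]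
  have hind : iIndepFun Y μ := iIndepFun_pi fun i => hfm.aemeasurable
  have hvarS : variance (∑ i, Y i) μ = ∑ i, (qfun Ω i x - qfun Ω i x ^ 2) := by
    rw [IndepFun.variance_sum (fun i _ => hYL i) fun i _ j _ hij => hind.indepFun hij]
    exact Finset.sum_congr rfl fun i _ => hvar i
  set c := vol (K ∩ Set.Iic x) / vol K with hc
  set n := (Fintype.card ι : ℝ) with hn
  have hd : (fun p => discrep K p x) = fun p => n⁻¹ * (∑ i, Y i) p - c := by
    funext p
    simp only [discrep, countIn, Finset.sum_apply, hY]
    ring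
  have hSL : MemLp (∑ i, Y i) 2 μ := memLp_finsetSum' _ fun i _ => hYL i
  have hmul : MemLp (fun p => n⁻¹ * (∑ i, Y i) p) 2 μ := hSL.const_mul _
  have hdL : MemLp (fun p => discrep K p x) 2 μ := by
    rw [hd]; exact hmul.sub (memLp_const c)
  have hvd : variance (fun p => discrep K p x) μ =
      (∑ i, (qfun Ω i x - qfun Ω i x ^ 2)) / n ^ 2 := by
    rw [hd, variance_sub_const hmul.aestronglyMeasurable, variance_const_mul, hvarS]
    ring
  have hEd : ∫ p, discrep K p x ∂μ = (∑ i, qfun Ω i x) / n - c := by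
    rw [hd, integral_sub (hmul.integrable one_le_two) (integrable_const c), integral_const_mul]
    simp only [Finset.sum_apply]
    rw [integral_finsetSum _ fun i _ => (hYL i).integrable one_le_two]
    simp [hEf]
    ring
  have h := variance_eq_sub hdL
  rw [hvd, hEd] at h
  simp only [Pi.pow_apply] at h
  linarith

lemma integrable_discrep_sq {K : Set (Fin d → ℝ)} (hK : MeasurableSet K) (hKfin : volume K ≠ ⊤)
    (μ : Measure (ι → (Fin d → ℝ))) [IsFiniteMeasure μ] :
    Integrable (fun z : (ι → (Fin d → ℝ)) × (Fin d → ℝ) => (discrep K z.1 z.2) ^ 2)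
      (μ.prod (volume.restrict K)) := by
  have : IsFiniteMeasure (volume.restrict K) := ⟨by simpa using hKfin.lt_top⟩
  refine Integrable.of_bound ((measurable_discrep hK).pow_const 2).aestronglyMeasurable 1
    (Filter.Eventually.of_forall fun z => ?_)
  rw [Real.norm_eq_abs, abs_of_nonneg (sq_nonneg _)]
  exact discrep_sq_le_one hKfin _ _

/-- Difference of the mean squared `L2`-discrepancies of two stratified samples. -/
lemma meanL2sq_sub {K : Set (Fin d → ℝ)} (hK : MeasurableSet K) (hKfin : volume K ≠ ⊤)
    (Ω Ω' : ι → Set (Fin d → ℝ))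
    (hmeas : ∀ i, MeasurableSet (Ω i)) (hpos : ∀ i, volume (Ω i) ≠ 0)
    (hfin : ∀ i, volume (Ω i) ≠ ⊤)
    (hmeas' : ∀ i, MeasurableSet (Ω' i)) (hpos' : ∀ i, volume (Ω' i) ≠ 0)
    (hfin' : ∀ i, volume (Ω' i) ≠ ⊤)
    (hsum : ∀ x ∈ K, ∑ i, qfun Ω i x = ∑ i, qfun Ω' i x) :
    meanL2sq K Ω - meanL2sq K Ω' =
      1 / vol K * ((1 / (Fintype.card ι : ℝ) ^ 2) *
        ∫ x in K, ∑ i, (qfun Ω' i x ^ 2 - qfun Ω i x ^ 2)) := by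
  have := isProbabilityMeasure_cond_volume Ω hpos hfin
  have := isProbabilityMeasure_cond_volume Ω' hpos' hfin'
  have hp : IsProbabilityMeasure (stratDist Ω) := by unfold stratDist; infer_instance
  have hp' : IsProbabilityMeasure (stratDist Ω') := by unfold stratDist; infer_instance
  have hi := integrable_discrep_sq hK hKfin (stratDist Ω)
  have hi' := integrable_discrep_sq hK hKfin (stratDist Ω')
  rw [meanL2sq, meanL2sq, integral_const_mul, integral_const_mul,
    integral_integral_swap (f := fun p x => discrep K p x ^ 2) hi,
    integral_integral_swap (f := fun p x => discrep K p x ^ 2) hi', ← mul_sub,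
    ← integral_sub hi.integral_prod_right hi'.integral_prod_right]
  congr 1
  rw [← integral_const_mul]
  refine setIntegral_congr_fun hK fun x hx => ?_
  simp only [integral_discrep_sq K Ω hmeas hpos hfin, integral_discrep_sq K Ω' hmeas' hpos' hfin',
    hsum x hx, Finset.sum_sub_distrib]
  ring

end MeanSquaredDiscrepancy

section ClampedIntegrals

/-- The projection of the real line onto the unit interval. -/
def clamp (y : ℝ) : ℝ := max 0 (min y 1)

lemma continuous_clamp : Continuous clamp := by
  unfold clamp; fun_prop

lemma clamp_of_nonpos {y : ℝ} (h : y ≤ 0) : clamp y = 0 := by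
  rw [clamp, max_eq_left ((min_le_left _ _).trans h)]

lemma clamp_of_one_le {y : ℝ} (h : 1 ≤ y) : clamp y = 1 := by
  rw [clamp, min_eq_right h, max_eq_right zero_le_one]

lemma clamp_of_mem {y : ℝ} (h0 : 0 ≤ y) (h1 : y ≤ 1) : clamp y = y := by
  rw [clamp, min_eq_left h1, max_eq_right h0]

lemma clamp_nonneg (y : ℝ) : 0 ≤ clamp y := le_max_left _ _

lemma clamp_le_one (y : ℝ) : clamp y ≤ 1 := max_le zero_le_one (min_le_right _ _)

lemma integral_max_sub_pow {c : ℝ} (hc : 0 ≤ c) (U : ℝ) {n : ℕ} (hn : n ≠ 0) :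
    ∫ u in (0 : ℝ)..U, max (u - c) 0 ^ n = max (U - c) 0 ^ (n + 1) / (n + 1) := by
  have hder : ∀ u : ℝ, HasDerivWithinAt (fun u => max (u - c) 0 ^ (n + 1) / ((n : ℝ) + 1))
      (max (u - c) 0 ^ n) (Set.Ioi u) u := by
    intro u
    rcases lt_or_ge u c with h | h
    · rw [max_eq_right (by linarith), zero_pow hn]
      refine ((hasDerivAt_const u (0 : ℝ)).congr_of_eventuallyEq ?_).hasDerivWithinAt
      filter_upwards [Iio_mem_nhds h] with v hv
      rw [max_eq_right (by linarith [Set.mem_Iio.1 hv])]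
      simp
    · rw [max_eq_left (by linarith)]
      have h1 : HasDerivAt (fun u => (u - c) ^ (n + 1) / ((n : ℝ) + 1)) ((u - c) ^ n) u := by
        have := (((hasDerivAt_id u).sub_const c).pow (n + 1)).div_const ((n : ℝ) + 1)
        refine this.congr_deriv ?_
        have : (n : ℝ) + 1 ≠ 0 := by positivity
        push_cast
        simp
        field_simp
      refine h1.hasDerivWithinAt.congr (fun v hv => ?_) ?_
      · rw [max_eq_left (by linarith [Set.mem_Ioi.1 hv])]
      · rw [max_eq_left (by linarith)]
  have hc1 : Continuous fun u : ℝ => max (u - c) 0 ^ (n + 1) / ((n : ℝ) + 1) := by fun_prop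
  have hc2 : Continuous fun u : ℝ => max (u - c) 0 ^ n := by fun_prop
  rw [intervalIntegral.integral_eq_sub_of_hasDeriv_right hc1.continuousOn
    (fun u _ => hder u) (hc2.intervalIntegrable _ _), max_eq_right (b := (0 : ℝ)) (a := 0 - c)
    (by linarith)]
  simp

lemma integral_comp_clamp {φ : ℝ → ℝ} (hφ : Continuous φ) {a l r : ℝ} (ha : 0 ≤ a) (hl : 0 < l)
    (hr : 0 ≤ r) (h : a + l + r = 1) :
    ∫ x in (0 : ℝ)..1, φ (clamp ((x - a) / l)) =
      a * φ 0 + l * (∫ u in (0 : ℝ)..1, φ u) + r * φ 1 := by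
  have hc : Continuous fun x => φ (clamp ((x - a) / l)) :=
    hφ.comp (continuous_clamp.comp (by fun_prop))
  have hi : ∀ s t, IntervalIntegrable (fun x => φ (clamp ((x - a) / l))) volume s t :=
    fun s t => hc.intervalIntegrable s t
  rw [← intervalIntegral.integral_add_adjacent_intervals (hi 0 a) (hi a 1),
    ← intervalIntegral.integral_add_adjacent_intervals (hi a (a + l)) (hi (a + l) 1), ← add_assoc]
  congr 1
  · congr 1
    · have : Set.EqOn (fun x => φ (clamp ((x - a) / l))) (fun _ => φ 0) (Set.uIcc 0 a) := by
        intro x hx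
        rw [Set.uIcc_of_le ha] at hx
        simp only
        rw [clamp_of_nonpos (div_nonpos_of_nonpos_of_nonneg (by linarith [hx.2]) hl.le)]
      rw [intervalIntegral.integral_congr this]
      simp
    · have : Set.EqOn (fun x => φ (clamp ((x - a) / l))) (fun x => φ (x / l - a / l))
          (Set.uIcc a (a + l)) := by
        intro x hx
        rw [Set.uIcc_of_le (by linarith)] at hx
        simp only
        rw [clamp_of_mem (div_nonneg (by linarith [hx.1]) hl.le)
          ((div_le_one hl).2 (by linarith [hx.2])), sub_div]
      rw [intervalIntegral.integral_congr this, intervalIntegral.integral_comp_div_sub _ hl.ne']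
      have e : (a + l) / l - a / l = 1 := by field_simp; ring
      rw [e, sub_self, smul_eq_mul]
  · have : Set.EqOn (fun x => φ (clamp ((x - a) / l))) (fun _ => φ 1) (Set.uIcc (a + l) 1) := by
      intro x hx
      rw [Set.uIcc_of_le (by linarith)] at hx
      simp only
      rw [clamp_of_one_le ((one_le_div hl).2 (by linarith [hx.1]))]
    rw [intervalIntegral.integral_congr this]
    simp
    left; linarith

/-- For `0 ≤ U, T ≤ 1`, the amount by which replacing the two squares by the two triangles changes
the product of the two box-volume fractions. -/
def fractionDefect (U T : ℝ) : ℝ :=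
  (2 * U * T - max (T - (1 - U)) 0 ^ 2) * max (T - (1 - U)) 0 ^ 2 - 2 * max (U - 1 / 2) 0 * T ^ 2

lemma fractionDefect_eq (U T : ℝ) :
    fractionDefect U T = 2 * U * max (T - (1 - U)) 0 ^ 3 +
      2 * U * (1 - U) * max (T - (1 - U)) 0 ^ 2 - max (T - (1 - U)) 0 ^ 4 -
        2 * max (U - 1 / 2) 0 * T ^ 2 := by
  unfold fractionDefect
  rcases le_total (T - (1 - U)) 0 with h | h
  · rw [max_eq_right h]; ring
  · rw [max_eq_left h]; ring

lemma continuous_fractionDefect : Continuous fun p : ℝ × ℝ => fractionDefect p.1 p.2 := by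
  unfold fractionDefect; fun_prop

lemma integral_fractionDefect_right {U : ℝ} (h0 : 0 ≤ U) (h1 : U ≤ 1) :
    ∫ T in (0 : ℝ)..1, fractionDefect U T =
      -(11 / 30) * U ^ 5 + 2 / 3 * U ^ 4 - 2 / 3 * max (U - 1 / 2) 0 := by
  have hc : 0 ≤ 1 - U := by linarith
  simp only [fractionDefect_eq]
  rw [intervalIntegral.integral_sub, intervalIntegral.integral_sub, intervalIntegral.integral_add,
    intervalIntegral.integral_const_mul, intervalIntegral.integral_const_mul,
    intervalIntegral.integral_const_mul, integral_max_sub_pow hc _ (by norm_num),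
    integral_max_sub_pow hc _ (by norm_num), integral_max_sub_pow hc _ (by norm_num), integral_pow,
    max_eq_left (by linarith)]
  · push_cast; ring
  all_goals exact Continuous.intervalIntegrable (by fun_prop) _ _

lemma setIntegral_Icc_eq_intervalIntegral {f : ℝ → ℝ → ℝ}
    (hf : Continuous fun p : ℝ × ℝ => f p.1 p.2) :
    ∫ x in Set.Icc (0 : Fin 2 → ℝ) 1, f (x 0) (x 1) =
      ∫ s in (0 : ℝ)..1, ∫ t in (0 : ℝ)..1, f s t := by
  have hpre : Set.Icc (0 : Fin 2 → ℝ) 1 =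
      MeasurableEquiv.finTwoArrow ⁻¹' (Set.Icc (0 : ℝ) 1 ×ˢ Set.Icc (0 : ℝ) 1) := by
    ext x
    simp [Set.mem_Icc, Pi.le_def, Fin.forall_fin_two]
  have h := (volume_preserving_finTwoArrow ℝ).setIntegral_preimage_emb
    (MeasurableEquiv.measurableEmbedding _) (fun p : ℝ × ℝ => f p.1 p.2)
    (Set.Icc (0 : ℝ) 1 ×ˢ Set.Icc (0 : ℝ) 1)
  rw [hpre]
  refine Eq.trans h ?_
  rw [Measure.volume_eq_prod, setIntegral_prod _
    (hf.continuousOn.integrableOn_compact (isCompact_Icc.prod isCompact_Icc))]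
  simp only [integral_Icc_eq_integral_Ioc, intervalIntegral.integral_of_le zero_le_one]

lemma integral_fractionDefect_clamp {a b l₁ l₂ r₁ r₂ : ℝ} (ha : 0 ≤ a) (hb : 0 ≤ b)
    (hl₁ : 0 < l₁) (hl₂ : 0 < l₂) (hr₁ : 0 ≤ r₁) (hr₂ : 0 ≤ r₂) (h₁ : a + l₁ + r₁ = 1)
    (h₂ : b + l₂ + r₂ = 1) :
    ∫ x in Set.Icc (0 : Fin 2 → ℝ) 1,
        fractionDefect (clamp ((x 0 - a) / l₁)) (clamp ((x 1 - b) / l₂)) =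
      l₁ * r₂ / 20 - l₁ * l₂ / 90 - r₁ * l₂ / 30 := by
  have hcl : ∀ a l : ℝ, Continuous fun x => clamp ((x - a) / l) :=
    fun a l => continuous_clamp.comp (by fun_prop)
  rw [setIntegral_Icc_eq_intervalIntegral (f := fun s t =>
    fractionDefect (clamp ((s - a) / l₁)) (clamp ((t - b) / l₂)))
    (continuous_fractionDefect.comp (((hcl a l₁).comp continuous_fst).prodMk
      ((hcl b l₂).comp continuous_snd)))]
  have inner : ∀ s : ℝ, ∫ t in (0 : ℝ)..1,
      fractionDefect (clamp ((s - a) / l₁)) (clamp ((t - b) / l₂)) =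
      (fun U => l₂ * (-(11 / 30) * U ^ 5 + 2 / 3 * U ^ 4 - 2 / 3 * max (U - 1 / 2) 0) +
        r₂ * (2 * U ^ 3 - U ^ 4 - 2 * max (U - 1 / 2) 0)) (clamp ((s - a) / l₁)) := by
    intro s
    set U := clamp ((s - a) / l₁) with hU
    have hU0 : 0 ≤ U := clamp_nonneg _
    have hU1 : U ≤ 1 := clamp_le_one _
    rw [integral_comp_clamp (φ := fractionDefect U)
      (continuous_fractionDefect.comp (Continuous.prodMk_right U)) hb hl₂ hr₂ h₂,
      integral_fractionDefect_right hU0 hU1]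
    have e0 : fractionDefect U 0 = 0 := by
      rw [fractionDefect, max_eq_right (by linarith)]; ring
    have e1 : fractionDefect U 1 = 2 * U ^ 3 - U ^ 4 - 2 * max (U - 1 / 2) 0 := by
      rw [fractionDefect, max_eq_left (a := 1 - (1 - U)) (by linarith)]; ring
    rw [e0, e1]
    ring
  simp only [inner]
  rw [integral_comp_clamp (φ := fun U => l₂ * (-(11 / 30) * U ^ 5 + 2 / 3 * U ^ 4 -
    2 / 3 * max (U - 1 / 2) 0) + r₂ * (2 * U ^ 3 - U ^ 4 - 2 * max (U - 1 / 2) 0)) (by fun_prop)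
    ha hl₁ hr₁ h₁]
  have hI : ∫ U in (0 : ℝ)..1, (l₂ * (-(11 / 30) * U ^ 5 + 2 / 3 * U ^ 4 -
      2 / 3 * max (U - 1 / 2) 0) + r₂ * (2 * U ^ 3 - U ^ 4 - 2 * max (U - 1 / 2) 0)) =
      -l₂ / 90 + r₂ / 20 := by
    have hramp : ∫ U in (0 : ℝ)..1, max (U - 1 / 2) 0 = 1 / 8 := by
      have := integral_max_sub_pow (c := 1 / 2) (by norm_num) 1 one_ne_zero
      simp only [pow_one] at this
      rw [this, max_eq_left (by norm_num)]
      norm_num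
    rw [intervalIntegral.integral_add, intervalIntegral.integral_const_mul,
      intervalIntegral.integral_const_mul, intervalIntegral.integral_sub,
      intervalIntegral.integral_sub, intervalIntegral.integral_sub, intervalIntegral.integral_add,
      intervalIntegral.integral_const_mul, intervalIntegral.integral_const_mul,
      intervalIntegral.integral_const_mul, intervalIntegral.integral_const_mul,
      intervalIntegral.integral_const_mul, hramp]
    · simp only [integral_pow]; norm_num; ring
    all_goals exact Continuous.intervalIntegrable (by fun_prop) _ _
  rw [hI]
  have m0 : max ((0 : ℝ) - 1 / 2) 0 = 0 := max_eq_right (by norm_num)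
  have m1 : max ((1 : ℝ) - 1 / 2) 0 = 1 / 2 := by rw [max_eq_left (by norm_num)]; norm_num
  simp only [m0, m1]
  ring

end ClampedIntegrals

section Volumes

lemma max_min_add_sub {a l : ℝ} (hl : 0 < l) (x : ℝ) :
    max (min (a + l) x - a) 0 = l * clamp ((x - a) / l) := by
  rcases le_total x a with h | h
  · rw [clamp_of_nonpos (div_nonpos_of_nonpos_of_nonneg (by linarith) hl.le), min_eq_right
      (by linarith), max_eq_right (by linarith), mul_zero]
  · rcases le_total (a + l) x with h' | h'
    · rw [clamp_of_one_le ((one_le_div hl).2 (by linarith)), min_eq_left h', max_eq_left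
        (by linarith)]
      ring
    · rw [clamp_of_mem (div_nonneg (by linarith) hl.le) ((div_le_one hl).2 (by linarith)),
        min_eq_right h', max_eq_left (by linarith)]
      field_simp

lemma vol_Icc_inter_Iic {a b l₁ l₂ : ℝ} (hl₁ : 0 < l₁) (hl₂ : 0 < l₂) (x : Fin 2 → ℝ) :
    vol (Set.Icc ![a, b] ![a + l₁, b + l₂] ∩ Set.Iic x) =
      l₁ * l₂ * (clamp ((x 0 - a) / l₁) * clamp ((x 1 - b) / l₂)) := by
  have : Set.Icc ![a, b] ![a + l₁, b + l₂] ∩ Set.Iic x =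
      Set.Icc ![a, b] (![a + l₁, b + l₂] ⊓ x) := by
    ext y
    simp only [Set.mem_inter_iff, Set.mem_Icc, Set.mem_Iic, le_inf_iff, and_assoc]
  rw [vol, this, Real.volume_Icc_pi, ENNReal.toReal_prod, Fin.prod_univ_two]
  simp only [ENNReal.toReal_ofReal', Pi.inf_apply, Matrix.cons_val_zero, Matrix.cons_val_one]
  rw [max_min_add_sub hl₁, max_min_add_sub hl₂]
  ring

/-- The right triangle with right angle at `(a, b)` and legs `l₁`, `l₂` along the axes. -/
def rightTriangle (a b l₁ l₂ : ℝ) : Set (Fin 2 → ℝ) :=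
  {y | a ≤ y 0 ∧ b ≤ y 1 ∧ (y 0 - a) / l₁ + (y 1 - b) / l₂ ≤ 1}

lemma convexHull_eq_rightTriangle {a b l₁ l₂ : ℝ} (hl₁ : 0 < l₁) (hl₂ : 0 < l₂) :
    convexHull ℝ {![a, b], ![a + l₁, b], ![a, b + l₂]} = rightTriangle a b l₁ l₂ := by
  apply Set.Subset.antisymm
  · refine convexHull_min ?_ ?_
    · rintro y (rfl | rfl | rfl)
      · simp [rightTriangle]
      · simp [rightTriangle, hl₁.le, hl₁.ne']
      · simp [rightTriangle, hl₂.le, hl₂.ne']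
    · rintro y ⟨h1, h2, h3⟩ z ⟨k1, k2, k3⟩ s t hs ht hst
      have hs' : s = 1 - t := by linarith
      refine ⟨?_, ?_, ?_⟩
      · simp only [Pi.add_apply, Pi.smul_apply, smul_eq_mul]
        subst hs'; nlinarith
      · simp only [Pi.add_apply, Pi.smul_apply, smul_eq_mul]
        subst hs'; nlinarith
      · simp only [Pi.add_apply, Pi.smul_apply, smul_eq_mul]
        have e : (s * y 0 + t * z 0 - a) / l₁ + (s * y 1 + t * z 1 - b) / l₂ =
            s * ((y 0 - a) / l₁ + (y 1 - b) / l₂) + t * ((z 0 - a) / l₁ + (z 1 - b) / l₂) := by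
          subst hs'; field_simp; ring
        rw [e]
        nlinarith
  · rintro y ⟨h1, h2, h3⟩
    set u := (y 0 - a) / l₁ with hu
    set t := (y 1 - b) / l₂ with ht
    have hu0 : 0 ≤ u := div_nonneg (by linarith) hl₁.le
    have ht0 : 0 ≤ t := div_nonneg (by linarith) hl₂.le
    have hy0 : y 0 = a + l₁ * u := by rw [hu]; field_simp; ring
    have hy1 : y 1 = b + l₂ * t := by rw [ht]; field_simp; ring
    have hconv := convex_convexHull ℝ ({![a, b], ![a + l₁, b], ![a, b + l₂]} : Set (Fin 2 → ℝ))
    have hy : y = ∑ i : Fin 3, (![1 - u - t, u, t] i) •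
        (![![a, b], ![a + l₁, b], ![a, b + l₂]] : Fin 3 → Fin 2 → ℝ) i := by
      funext i
      fin_cases i
      · simp [Fin.sum_univ_three, hy0]; ring
      · simp [Fin.sum_univ_three, hy1]; ring
    rw [hy]
    refine hconv.sum_mem (fun i _ => ?_) ?_ (fun i _ => subset_convexHull ℝ _ ?_)
    · fin_cases i
      · simp; linarith
      · simpa using hu0
      · simpa using ht0
    · simp only [Fin.sum_univ_three, Matrix.cons_val]
      ring
    · fin_cases i <;> simp

lemma isClosed_rightTriangle (a b l₁ l₂ : ℝ) : IsClosed (rightTriangle a b l₁ l₂) :=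
  (isClosed_le continuous_const (continuous_apply 0)).inter
    ((isClosed_le continuous_const (continuous_apply 1)).inter
      (isClosed_le (f := fun y : Fin 2 → ℝ => (y 0 - a) / l₁ + (y 1 - b) / l₂) (by fun_prop)
        continuous_const))

lemma rightTriangle_subset_Icc {a b l₁ l₂ : ℝ} (hl₁ : 0 < l₁) (hl₂ : 0 < l₂) :
    rightTriangle a b l₁ l₂ ⊆ Set.Icc ![a, b] ![a + l₁, b + l₂] := by
  rintro y ⟨h1, h2, h3⟩
  have hu0 : 0 ≤ (y 0 - a) / l₁ := div_nonneg (by linarith) hl₁.le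
  have ht0 : 0 ≤ (y 1 - b) / l₂ := div_nonneg (by linarith) hl₂.le
  have hu1 := (div_le_one hl₁).1 (show (y 0 - a) / l₁ ≤ 1 by linarith)
  have ht1 := (div_le_one hl₂).1 (show (y 1 - b) / l₂ ≤ 1 by linarith)
  simp only [Set.mem_Icc, Pi.le_def, Fin.forall_fin_two, Matrix.cons_val_zero, Matrix.cons_val_one]
  refine ⟨⟨h1, h2⟩, by linarith, by linarith⟩

lemma integral_max_min_one_sub {X Y : ℝ} (hX : 0 ≤ X) (hY : 0 ≤ Y) :
    ∫ u in (0 : ℝ)..X, max (min Y (1 - u)) 0 =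
      clamp X * clamp Y - max (clamp Y - (1 - clamp X)) 0 ^ 2 / 2 := by
  have hT0 := clamp_nonneg Y
  have hT1 := clamp_le_one Y
  have hEq : Set.EqOn (fun u => max (min Y (1 - u)) 0)
      (fun u => clamp Y - max (u - (1 - clamp Y)) 0 ^ 1 + max (u - 1) 0 ^ 1) (Set.uIcc 0 X) := by
    intro u hu
    rw [Set.uIcc_of_le hX] at hu
    have hu0 := hu.1
    simp only [pow_one, clamp]
    rcases le_total Y 1 with h1 | h1 <;>
    rcases le_total u 1 with h2 | h2 <;>
    rcases le_total Y (1 - u) with h3 | h3 <;>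
    simp only [max_def, min_def] <;> split_ifs <;> linarith
  rw [intervalIntegral.integral_congr hEq, intervalIntegral.integral_add,
    intervalIntegral.integral_sub, integral_max_sub_pow (by linarith) _ one_ne_zero,
    integral_max_sub_pow zero_le_one _ one_ne_zero, intervalIntegral.integral_const]
  · rcases le_total X 1 with h | h
    · rw [clamp_of_mem hX h, max_eq_right (a := X - 1) (by linarith),
        show X - (1 - clamp Y) = clamp Y - (1 - X) by ring]
      norm_num
    · rw [clamp_of_one_le h, max_eq_left (a := X - 1) (by linarith),
        max_eq_left (a := X - (1 - clamp Y)) (by linarith), max_eq_left (by linarith)]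
      norm_num
      ring
  all_goals exact Continuous.intervalIntegrable (by fun_prop) _ _

lemma vol_rightTriangle_inter_Iic {a b l₁ l₂ : ℝ} (hl₁ : 0 < l₁) (hl₂ : 0 < l₂)
    (x : Fin 2 → ℝ) :
    vol (rightTriangle a b l₁ l₂ ∩ Set.Iic x) =
      l₁ * l₂ * (clamp ((x 0 - a) / l₁) * clamp ((x 1 - b) / l₂) -
        max (clamp ((x 1 - b) / l₂) - (1 - clamp ((x 0 - a) / l₁))) 0 ^ 2 / 2) := by
  by_cases hx : a ≤ x 0 ∧ b ≤ x 1
  swap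
  · have hempty : rightTriangle a b l₁ l₂ ∩ Set.Iic x = ∅ := by
      refine Set.eq_empty_of_forall_notMem ?_
      rintro y ⟨⟨h1, h2, -⟩, hy⟩
      exact hx ⟨h1.trans (hy 0), h2.trans (hy 1)⟩
    rw [hempty, vol, measure_empty, ENNReal.toReal_zero]
    rw [not_and_or, not_le, not_le] at hx
    rcases hx with h | h
    · rw [clamp_of_nonpos (y := (x 0 - a) / l₁)
        (div_nonpos_of_nonpos_of_nonneg (by linarith) hl₁.le),
        max_eq_right (by linarith [clamp_le_one ((x 1 - b) / l₂)])]
      ring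
    · rw [clamp_of_nonpos (y := (x 1 - b) / l₂)
        (div_nonpos_of_nonpos_of_nonneg (by linarith) hl₂.le),
        max_eq_right (by linarith [clamp_le_one ((x 0 - a) / l₁)])]
      ring
  obtain ⟨hx0, hx1⟩ := hx
  set g : ℝ → ℝ := fun s => min (x 1) (b + l₂ * (1 - (s - a) / l₁)) - b with hg
  set S : Set (ℝ × ℝ) := {p | a ≤ p.1 ∧ b ≤ p.2 ∧ (p.1 - a) / l₁ + (p.2 - b) / l₂ ≤ 1 ∧
    p.1 ≤ x 0 ∧ p.2 ≤ x 1} with hS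
  have hpre : rightTriangle a b l₁ l₂ ∩ Set.Iic x = MeasurableEquiv.finTwoArrow ⁻¹' S := by
    ext y
    simp [rightTriangle, hS, Pi.le_def, Fin.forall_fin_two, and_assoc]
  have hSm : MeasurableSet S := by
    refine IsClosed.measurableSet ?_
    exact (isClosed_le continuous_const continuous_fst).inter
      ((isClosed_le continuous_const continuous_snd).inter
      ((isClosed_le (f := fun p : ℝ × ℝ => (p.1 - a) / l₁ + (p.2 - b) / l₂) (by fun_prop)
        continuous_const).inter
      ((isClosed_le continuous_fst continuous_const).inter
      (isClosed_le continuous_snd continuous_const))))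
  have hslice : ∀ s, volume (Prod.mk s ⁻¹' S) =
      (Set.Icc a (x 0)).indicator (fun s => ENNReal.ofReal (max (g s) 0)) s := by
    intro s
    by_cases hs : s ∈ Set.Icc a (x 0)
    · rw [Set.indicator_of_mem hs]
      have : Prod.mk s ⁻¹' S = Set.Icc b (min (x 1) (b + l₂ * (1 - (s - a) / l₁))) := by
        ext t
        simp only [hS, Set.mem_preimage, Set.mem_ofPred_eq, Set.mem_Icc, le_min_iff]
        have : (s - a) / l₁ + (t - b) / l₂ ≤ 1 ↔ t ≤ b + l₂ * (1 - (s - a) / l₁) := by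
          rw [← le_sub_iff_add_le', div_le_iff₀ hl₂]
          constructor <;> intro h <;> linarith
        rw [this]
        have := hs.1
        have := hs.2
        tauto
      rw [this, Real.volume_Icc]
      simp only [hg]
      rw [ENNReal.ofReal_max, ENNReal.ofReal_zero, max_eq_left (by positivity)]
    · rw [Set.indicator_of_notMem hs]
      have : Prod.mk s ⁻¹' S = ∅ := by
        refine Set.eq_empty_of_forall_notMem ?_
        rintro t ⟨h1, -, -, h2, -⟩
        exact hs ⟨h1, h2⟩
      rw [this, measure_empty]
  have hgc : Continuous fun s => max (g s) 0 := by simp only [hg]; fun_prop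
  rw [vol, hpre, (volume_preserving_finTwoArrow ℝ).measure_preimage_equiv, Measure.volume_eq_prod,
    Measure.prod_apply hSm]
  simp only [hslice]
  rw [lintegral_indicator measurableSet_Icc, ← ofReal_integral_eq_lintegral_ofReal
    hgc.continuousOn.integrableOn_Icc (Filter.Eventually.of_forall fun s => le_max_right _ _),
    ENNReal.toReal_ofReal (integral_nonneg (f := fun s => max (g s) 0) fun s => le_max_right _ _),
    integral_Icc_eq_integral_Ioc, ← intervalIntegral.integral_of_le hx0]
  have hgs : ∀ s, max (g s) 0 =
      l₂ * (fun u => max (min ((x 1 - b) / l₂) (1 - u)) 0) (s / l₁ - a / l₁) := by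
    intro s
    simp only [hg]
    rw [mul_max_of_nonneg _ _ hl₂.le, mul_min_of_nonneg _ _ hl₂.le, mul_zero, mul_div_cancel₀ _
      hl₂.ne', ← min_sub_sub_right, ← sub_div]
    congr 2
    ring
  simp only [hgs]
  rw [intervalIntegral.integral_const_mul, intervalIntegral.integral_comp_div_sub
    (fun u => max (min ((x 1 - b) / l₂) (1 - u)) 0) hl₁.ne', sub_self, ← sub_div,
    integral_max_min_one_sub (div_nonneg (by linarith) hl₁.le) (div_nonneg (by linarith) hl₂.le),
    smul_eq_mul]
  ring

end Volumes

section ModifiedPartition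

lemma vol_Icc {a b l₁ l₂ : ℝ} (hl₁ : 0 < l₁) (hl₂ : 0 < l₂) :
    vol (Set.Icc ![a, b] ![a + l₁, b + l₂]) = l₁ * l₂ := by
  rw [← Set.inter_eq_self_of_subset_left
    (Set.Icc_subset_Iic_self (a := ![a, b]) (b := ![a + l₁, b + l₂])), vol_Icc_inter_Iic hl₁ hl₂]
  simp [clamp, hl₁.ne', hl₂.ne']

lemma vol_rightTriangle {a b l₁ l₂ : ℝ} (hl₁ : 0 < l₁) (hl₂ : 0 < l₂) :
    vol (rightTriangle a b l₁ l₂) = l₁ * l₂ / 2 := by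
  rw [← Set.inter_eq_self_of_subset_left ((rightTriangle_subset_Icc hl₁ hl₂).trans
    (Set.Icc_subset_Iic_self (a := ![a, b]) (b := ![a + l₁, b + l₂]))),
    vol_rightTriangle_inter_Iic hl₁ hl₂]
  simp [clamp, hl₁.ne', hl₂.ne']
  ring

lemma vol_diff_interior_inter {d : ℕ} {R T : Set (Fin d → ℝ)} (A : Set (Fin d → ℝ))
    (hA : MeasurableSet A) (hT : Convex ℝ T) (hTm : MeasurableSet T) (hTR : T ⊆ R)
    (hR : volume R ≠ ⊤) : vol ((R \ interior T) ∩ A) = vol (R ∩ A) - vol (T ∩ A) := by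
  have hae : ((R \ interior T) ∩ A : Set (Fin d → ℝ)) =ᵐ[volume] ((R ∩ A) \ (T ∩ A) : Set _) := by
    rw [← Set.inter_sdiff_distrib_right]
    exact ((Filter.EventuallyEq.refl _ R).diff
      (interior_ae_eq_of_null_frontier (hT.addHaar_frontier volume))).inter
      (Filter.EventuallyEq.refl _ A)
  rw [vol, measure_congr hae]
  exact measureReal_sdiff (Set.inter_subset_inter_left A hTR) (hTm.inter hA)
    (ne_top_of_le_ne_top hR (measure_mono Set.inter_subset_left))

lemma clamp_two_mul_add (y : ℝ) : clamp (2 * y) + clamp (2 * y - 1) = 2 * clamp y := by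
  simp only [clamp, max_def, min_def]
  split_ifs <;> linarith

lemma clamp_two_mul_mul (y : ℝ) :
    clamp (2 * y) * clamp (2 * y - 1) = 2 * max (clamp y - 1 / 2) 0 := by
  rcases le_total y (1 / 2) with h | h
  · rw [clamp_of_nonpos (y := 2 * y - 1) (by linarith), max_eq_right]
    · ring
    · simp only [clamp, max_def, min_def]
      split_ifs <;> linarith
  · rw [clamp_of_one_le (y := 2 * y) (by linarith)]
    simp only [clamp, max_def, min_def]
    split_ifs <;> linarith

lemma jitteredCube_eq_Icc (m : ℕ) (i : Fin 2 → Fin m) :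
    jitteredCube m i = Set.Icc ![(i 0 : ℝ) / m, (i 1 : ℝ) / m]
      ![(i 0 : ℝ) / m + 1 / m, (i 1 : ℝ) / m + 1 / m] := by
  unfold jitteredCube
  congr 1
  · funext k
    fin_cases k <;> rfl
  · funext k
    fin_cases k <;> simp [add_div]

lemma qfun_jitteredCube {m : ℕ} (hm : 0 < m) (i : Fin 2 → Fin m) (x : Fin 2 → ℝ) :
    qfun (jitteredCube m) i x =
      clamp ((x 0 - (i 0 : ℝ) / m) / (1 / m)) * clamp ((x 1 - (i 1 : ℝ) / m) / (1 / m)) := by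
  have h : (0 : ℝ) < 1 / m := by positivity
  rw [qfun, jitteredCube_eq_Icc, vol_Icc_inter_Iic h h, vol_Icc h h]
  exact mul_div_cancel_left₀ _ (mul_pos h h).ne'

lemma rectI_eq_Icc (m j k : ℕ) :
    rectI m j k = Set.Icc ![1 - (j : ℝ) / m - 2 / m, 1 - (k : ℝ) / m - 1 / m]
      ![1 - (j : ℝ) / m - 2 / m + 2 / m, 1 - (k : ℝ) / m - 1 / m + 1 / m] := by
  rw [rectI, sub_add_cancel, sub_add_cancel]

lemma tri₁_eq_rightTriangle {m : ℕ} (hm : 0 < m) (j k : ℕ) :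
    tri₁ m j k = rightTriangle (1 - (j : ℝ) / m - 2 / m) (1 - (k : ℝ) / m - 1 / m)
      (2 / m) (1 / m) := by
  rw [← convexHull_eq_rightTriangle (by positivity) (by positivity), tri₁, sub_add_cancel,
    sub_add_cancel]

lemma measurableSet_tri₁ {m : ℕ} (hm : 0 < m) (j k : ℕ) : MeasurableSet (tri₁ m j k) := by
  rw [tri₁_eq_rightTriangle hm]
  exact (isClosed_rightTriangle _ _ _ _).measurableSet

lemma measurableSet_tri₂ (m j k : ℕ) : MeasurableSet (tri₂ m j k) :=
  measurableSet_Icc.diff isOpen_interior.measurableSet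

lemma vol_tri₁ {m : ℕ} (hm : 0 < m) (j k : ℕ) : vol (tri₁ m j k) = 1 / (m : ℝ) ^ 2 := by
  rw [tri₁_eq_rightTriangle hm, vol_rightTriangle (by positivity) (by positivity)]
  field_simp

lemma vol_tri₁_inter_Iic {m : ℕ} (hm : 0 < m) (j k : ℕ) (x : Fin 2 → ℝ) :
    vol (tri₁ m j k ∩ Set.Iic x) = 1 / (m : ℝ) ^ 2 *
      (2 * clamp ((x 0 - (1 - (j : ℝ) / m - 2 / m)) / (2 / m)) *
        clamp ((x 1 - (1 - (k : ℝ) / m - 1 / m)) / (1 / m)) -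
      max (clamp ((x 1 - (1 - (k : ℝ) / m - 1 / m)) / (1 / m)) -
        (1 - clamp ((x 0 - (1 - (j : ℝ) / m - 2 / m)) / (2 / m)))) 0 ^ 2) := by
  rw [tri₁_eq_rightTriangle hm, vol_rightTriangle_inter_Iic (by positivity) (by positivity)]
  ring

lemma vol_tri₂_inter {m : ℕ} (hm : 0 < m) (j k : ℕ) {A : Set (Fin 2 → ℝ)}
    (hA : MeasurableSet A) :
    vol (tri₂ m j k ∩ A) = vol (rectI m j k ∩ A) - vol (tri₁ m j k ∩ A) := by
  refine vol_diff_interior_inter A hA (convex_convexHull ℝ _) (measurableSet_tri₁ hm j k) ?_ ?_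
  · rw [tri₁_eq_rightTriangle hm, rectI_eq_Icc]
    exact rightTriangle_subset_Icc (by positivity) (by positivity)
  · exact isCompact_Icc.measure_ne_top

lemma vol_tri₂ {m : ℕ} (hm : 0 < m) (j k : ℕ) : vol (tri₂ m j k) = 1 / (m : ℝ) ^ 2 := by
  have h := vol_tri₂_inter hm j k MeasurableSet.univ
  simp only [Set.inter_univ] at h
  rw [h, vol_tri₁ hm, rectI_eq_Icc, vol_Icc (by positivity) (by positivity)]
  ring

lemma vol_tri₂_inter_Iic {m : ℕ} (hm : 0 < m) (j k : ℕ) (x : Fin 2 → ℝ) :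
    vol (tri₂ m j k ∩ Set.Iic x) = 1 / (m : ℝ) ^ 2 *
      max (clamp ((x 1 - (1 - (k : ℝ) / m - 1 / m)) / (1 / m)) -
        (1 - clamp ((x 0 - (1 - (j : ℝ) / m - 2 / m)) / (2 / m)))) 0 ^ 2 := by
  rw [vol_tri₂_inter hm j k measurableSet_Iic, vol_tri₁_inter_Iic hm, rectI_eq_Icc,
    vol_Icc_inter_Iic (by positivity) (by positivity)]
  ring

end ModifiedPartition

/-- The modification of the jittered partition at position `z = (j/m, k/m)` (replacing
the two jittered squares whose union is `I = [1−z₁−2/m, 1−z₁] × [1−z₂−1/m, 1−z₂]` by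
the two triangles) strictly improves the mean squared L2-discrepancy if and only if
`z₂ < 2/(9m) + z₁/3`. -/
theorem modified_lt_jittered_iff (m j k : ℕ) (hm : 2 ≤ m)
    (hj : j ≤ m - 2) (hk : k ≤ m - 1)
    (Ωmod : (Fin 2 → Fin m) → Set (Fin 2 → ℝ))
    (hL : Ωmod (idxL m j k hm hj hk) = tri₁ m j k)
    (hR : Ωmod (idxR m j k hm hj hk) = tri₂ m j k)
    (hrest : ∀ i, i ≠ idxL m j k hm hj hk → i ≠ idxR m j k hm hj hk →
      Ωmod i = jitteredCube m i) :
    meanL2sq (Set.Icc (0 : Fin 2 → ℝ) 1) Ωmod <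
        meanL2sq (Set.Icc (0 : Fin 2 → ℝ) 1) (jitteredCube m) ↔
      (k : ℝ) / m < 2 / (9 * m) + ((j : ℝ) / m) / 3 := by

  have hm0 : 0 < m := by omega
  have hmR : (0 : ℝ) < m := by exact_mod_cast hm0
  set L := idxL m j k hm hj hk with hLdef
  set R := idxR m j k hm hj hk with hRdef
  have hLR : L ≠ R := by
    intro h
    have := congrArg Fin.val (congrFun h 0)
    simp [hLdef, hRdef, idxL, idxR] at this
    omega
  set a : ℝ := 1 - (j : ℝ) / m - 2 / m with ha
  set b : ℝ := 1 - (k : ℝ) / m - 1 / m with hb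
  have hjm : j + 2 ≤ m := by omega
  have hkm : k + 1 ≤ m := by omega
  have hL0 : (L 0 : ℝ) / m = a := by
    have : ((L 0 : ℕ) : ℝ) = m - 2 - j := by
      simp only [hLdef, idxL, Fin.val_zero, if_true]
      rw [Nat.sub_sub, Nat.cast_sub (by omega)]
      push_cast; ring
    rw [this, ha]
    field_simp
    ring
  have hR0 : (R 0 : ℝ) / m = a + 1 / m := by
    have : ((R 0 : ℕ) : ℝ) = m - 1 - j := by
      simp only [hRdef, idxR, Fin.val_zero, if_true]
      rw [Nat.sub_sub, Nat.cast_sub (by omega)]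
      push_cast; ring
    rw [this, ha]
    field_simp
    ring
  have hb1 : ((m - 1 - k : ℕ) : ℝ) / m = b := by
    rw [Nat.sub_sub, Nat.cast_sub (by omega), hb]
    push_cast
    field_simp
    ring
  have hL1 : (L 1 : ℝ) / m = b := hb1
  have hR1 : (R 1 : ℝ) / m = b := hb1
  have hposj : ∀ i, 0 < vol (jitteredCube m i) := fun i => by
    rw [jitteredCube_eq_Icc, vol_Icc (by positivity) (by positivity)]
    positivity
  have hmeasj : ∀ i : Fin 2 → Fin m, MeasurableSet (jitteredCube m i) := fun i => measurableSet_Icc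
  have hcases : ∀ P : Set (Fin 2 → ℝ) → Prop, P (tri₁ m j k) → P (tri₂ m j k) →
      (∀ i, P (jitteredCube m i)) → ∀ i, P (Ωmod i) := by
    intro P h1 h2 h3 i
    by_cases hiL : i = L
    · rw [hiL, hL]; exact h1
    by_cases hiR : i = R
    · rw [hiR, hR]; exact h2
    rw [hrest i hiL hiR]; exact h3 i
  have hmeas : ∀ i, MeasurableSet (Ωmod i) :=
    hcases _ (measurableSet_tri₁ hm0 j k) (measurableSet_tri₂ m j k) hmeasj
  have hpos : ∀ i, 0 < vol (Ωmod i) := by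
    refine hcases (fun s => 0 < vol s) ?_ ?_ hposj
    · rw [vol_tri₁ hm0]; positivity
    · rw [vol_tri₂ hm0]; positivity
  have hK : vol (Set.Icc (0 : Fin 2 → ℝ) 1) = 1 := by
    simp [vol, Real.volume_Icc_pi]
  set U : (Fin 2 → ℝ) → ℝ := fun x => clamp ((x 0 - a) / (2 / m)) with hU
  set T : (Fin 2 → ℝ) → ℝ := fun x => clamp ((x 1 - b) / (1 / m)) with hT
  have hqL : ∀ x, qfun (jitteredCube m) L x = clamp (2 * ((x 0 - a) / (2 / m))) * T x := by
    intro x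
    rw [qfun_jitteredCube hm0, hL0, hL1]
    congr 2
    field_simp
  have hqR : ∀ x, qfun (jitteredCube m) R x = clamp (2 * ((x 0 - a) / (2 / m)) - 1) * T x := by
    intro x
    rw [qfun_jitteredCube hm0, hR0, hR1]
    congr 2
    field_simp
    ring
  have hpL : ∀ x, qfun Ωmod L x = 2 * U x * T x - max (T x - (1 - U x)) 0 ^ 2 := by
    intro x
    rw [qfun, hL, vol_tri₁_inter_Iic hm0, vol_tri₁ hm0]
    exact mul_div_cancel_left₀ _ (by positivity)
  have hpR : ∀ x, qfun Ωmod R x = max (T x - (1 - U x)) 0 ^ 2 := by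
    intro x
    rw [qfun, hR, vol_tri₂_inter_Iic hm0, vol_tri₂ hm0]
    exact mul_div_cancel_left₀ _ (by positivity)
  have hq : ∀ i, i ≠ L ∧ i ≠ R → ∀ x, qfun Ωmod i x = qfun (jitteredCube m) i x := by
    intro i hi x
    rw [qfun, qfun, hrest i hi.1 hi.2]
  have hsum2 : ∀ x, qfun Ωmod L x + qfun Ωmod R x =
      qfun (jitteredCube m) L x + qfun (jitteredCube m) R x := by
    intro x
    rw [hpL, hpR, hqL, hqR, ← add_mul, clamp_two_mul_add]
    ring
  have hsum : ∀ x, ∑ i, qfun Ωmod i x = ∑ i, qfun (jitteredCube m) i x := by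
    intro x
    rw [← sub_eq_zero, ← Finset.sum_sub_distrib, Fintype.sum_eq_add L R hLR
      fun i hi => sub_eq_zero.2 (hq i hi x)]
    linarith [hsum2 x]
  have hint : ∀ x, ∑ i, (qfun (jitteredCube m) i x ^ 2 - qfun Ωmod i x ^ 2) =
      2 * fractionDefect (U x) (T x) := by
    intro x
    rw [Fintype.sum_eq_add L R hLR fun i hi => by rw [hq i hi x, sub_self]]
    have h1 : qfun (jitteredCube m) L x * qfun (jitteredCube m) R x =
        2 * max (U x - 1 / 2) 0 * T x ^ 2 := by
      rw [hqL, hqR, ← clamp_two_mul_mul]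
      ring
    have h2 : fractionDefect (U x) (T x) = qfun Ωmod L x * qfun Ωmod R x -
        qfun (jitteredCube m) L x * qfun (jitteredCube m) R x := by
      rw [h1, hpL, hpR, fractionDefect]
    rw [h2]
    linear_combination (-(qfun Ωmod L x + qfun Ωmod R x) -
      (qfun (jitteredCube m) L x + qfun (jitteredCube m) R x)) * hsum2 x
  have ha0 : 0 ≤ a := by rw [← hL0]; positivity
  have hb0 : 0 ≤ b := by rw [← hL1]; positivity
  have hsub := meanL2sq_sub (K := Set.Icc (0 : Fin 2 → ℝ) 1) measurableSet_Icc
    isCompact_Icc.measure_ne_top Ωmod (jitteredCube m) hmeas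
    (fun i => (ENNReal.toReal_ne_zero.1 (hpos i).ne').1)
    (fun i => (ENNReal.toReal_ne_zero.1 (hpos i).ne').2) hmeasj
    (fun i => (ENNReal.toReal_ne_zero.1 (hposj i).ne').1)
    (fun i => (ENNReal.toReal_ne_zero.1 (hposj i).ne').2) fun x _ => hsum x
  simp only [hint] at hsub
  rw [integral_const_mul, integral_fractionDefect_clamp (r₁ := (j : ℝ) / m) (r₂ := (k : ℝ) / m)
    ha0 hb0 (by positivity) (by positivity) (by positivity) (by positivity) (by rw [ha]; ring)
    (by rw [hb]; ring), hK] at hsub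
  rw [← sub_neg, hsub]
  have hN : (0 : ℝ) < Fintype.card (Fin 2 → Fin m) := by
    have : Nonempty (Fin 2 → Fin m) := ⟨L⟩
    exact_mod_cast Fintype.card_pos
  have hfac : 1 / 1 * (1 / (Fintype.card (Fin 2 → Fin m) : ℝ) ^ 2 *
      (2 * (2 / m * ((k : ℝ) / m) / 20 - 2 / m * (1 / m) / 90 - (j : ℝ) / m * (1 / m) / 30))) =
      1 / (Fintype.card (Fin 2 → Fin m) : ℝ) ^ 2 * (1 / (5 * m)) *
        ((k : ℝ) / m - (2 / (9 * m) + ((j : ℝ) / m) / 3)) := by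
    field_simp
    ring
  rw [hfac, ← sub_neg (a := (k : ℝ) / m)]
  have hc : 0 < 1 / (Fintype.card (Fin 2 → Fin m) : ℝ) ^ 2 * (1 / (5 * m)) := by positivity
  exact smul_neg_iff_of_pos_left hc

end StratifiedSampling
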